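/- Let (Ω, μ) be a probability space, let η > 1, ε ∈ (0,1), δ ∈ (0,1), and let θ : ℕ satisfy (θ : ℝ) ≥ (2 * η ^ 2 / ε) * Real.log (1 / (δ * ε)) (in particular θ ≥ ⌈(2η²/ε) log(1/(δε))⌉ suffices). Let X : Fin θ → Ω → ℝ be independent random variables, each taking values in [0, 1] almost surely, each with expectation φ where ε ≤ φ. Then μ {ω | φ − (1 / (θ : ℝ)) * ∑ i, X i ω ≥ φ / η} ≤ ENNReal.ofReal (δ * ε). -/

import Mathlib

open MeasureTheory ProbabilityTheory

theorem Real.exp_neg_le_quadratic {s : ℝ} (hs : 0 ≤ s) :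
    Real.exp (-s) ≤ 1 - s + s ^ 2 / 2 := by
  have hquad := Real.quadratic_le_exp_of_nonneg hs
  have hpos : 0 < 1 - s + s ^ 2 / 2 := by nlinarith [sq_nonneg (s - 1)]
  rw [Real.exp_neg, inv_le_iff_one_le_mul₀ (Real.exp_pos s)]
  calc (1 : ℝ) ≤ (1 - s + s ^ 2 / 2) * (1 + s + s ^ 2 / 2) := by nlinarith [sq_nonneg (s ^ 2)]
    _ ≤ (1 - s + s ^ 2 / 2) * Real.exp s := by gcongr

/-- Upper bound at `-t` on the moment generating function of a `[0, 1]`-valued random variable. -/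
theorem mgf_neg_le_of_mem_Icc_zero_one {Ω : Type*} [MeasurableSpace Ω] {μ : Measure Ω}
    [IsProbabilityMeasure μ] {X : Ω → ℝ} (hX : AEMeasurable X μ)
    (hbound : ∀ᵐ ω ∂μ, X ω ∈ Set.Icc (0 : ℝ) 1) {t : ℝ} (ht : 0 ≤ t) :
    mgf X μ (-t) ≤ Real.exp ((-t + t ^ 2 / 2) * ∫ ω, X ω ∂μ) := by
  have hint : Integrable X μ := Integrable.of_mem_Icc 0 1 hX hbound
  calc mgf X μ (-t) ≤ ∫ ω, (1 + (-t + t ^ 2 / 2) * X ω) ∂μ := by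
        refine integral_mono_ae (integrable_exp_mul_of_mem_Icc hX hbound)
          ((integrable_const 1).add (hint.const_mul _)) ?_
        filter_upwards [hbound] with ω ⟨h0, h1⟩
        have hexp := Real.exp_neg_le_quadratic (mul_nonneg ht h0)
        have hsq : t ^ 2 * (X ω * X ω) ≤ t ^ 2 * X ω := by
          gcongr
          exact mul_le_of_le_one_left h0 h1
        rw [neg_mul]
        linarith
    _ = (-t + t ^ 2 / 2) * (∫ ω, X ω ∂μ) + 1 := by
        rw [integral_add (integrable_const 1) (hint.const_mul _), integral_const_mul]
        simp [add_comm]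
    _ ≤ _ := Real.add_one_le_exp _

/-- Multiplicative Chernoff bound for the lower tail of a sum of independent `[0, 1]`-valued
random variables with common mean `m`. -/
theorem measureReal_sum_le_one_sub_mul_le {Ω ι : Type*} [MeasurableSpace Ω] {μ : Measure Ω}
    [IsProbabilityMeasure μ] [Fintype ι] {X : ι → Ω → ℝ} (hX : ∀ i, AEMeasurable (X i) μ)
    (hind : iIndepFun X μ) (hbound : ∀ i, ∀ᵐ ω ∂μ, X i ω ∈ Set.Icc (0 : ℝ) 1)
    {m : ℝ} (hmean : ∀ i, ∫ ω, X i ω ∂μ = m) {t : ℝ} (ht : 0 ≤ t) :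
    μ.real {ω | ∑ i, X i ω ≤ (1 - t) * (Fintype.card ι * m)} ≤
      Real.exp (-(Fintype.card ι * m * t ^ 2 / 2)) := by
  have hsum : ∀ᵐ ω ∂μ, (∑ i, X i) ω ∈ Set.Icc (0 : ℝ) (Fintype.card ι) := by
    filter_upwards [ae_all_iff.2 hbound] with ω hω
    rw [Finset.sum_apply]
    refine ⟨Finset.sum_nonneg fun i _ ↦ (hω i).1, ?_⟩
    simpa using Finset.sum_le_sum fun i (_ : i ∈ Finset.univ) ↦ (hω i).2
  have hmeas : AEMeasurable (∑ i, X i) μ := Finset.aemeasurable_sum _ fun i _ ↦ hX i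
  have htail := measure_le_le_exp_mul_mgf ((1 - t) * (Fintype.card ι * m))
    (neg_nonpos.2 ht) (integrable_exp_mul_of_mem_Icc hmeas hsum)
  simp only [Finset.sum_apply] at htail
  refine htail.trans ?_
  rw [hind.mgf_sum₀ hX]
  calc _ ≤ Real.exp (- -t * ((1 - t) * (Fintype.card ι * m))) *
        ∏ _i : ι, Real.exp ((-t + t ^ 2 / 2) * m) := by
        gcongr with i
        · exact fun _ _ ↦ mgf_nonneg
        · rw [← hmean i]
          exact mgf_neg_le_of_mem_Icc_zero_one (hX i) (hbound i) ht
    _ = _ := by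
        rw [Finset.prod_const, Finset.card_univ, ← Real.exp_nat_mul, ← Real.exp_add]
        ring_nf

theorem chernoff_underestimate_bound
    {Ω : Type*} [MeasurableSpace Ω] (μ : Measure Ω) [IsProbabilityMeasure μ]
    (η ε δ : ℝ) (hη : 1 < η) (hε0 : 0 < ε) (hε1 : ε < 1) (hδ0 : 0 < δ) (hδ1 : δ < 1)
    (θ : ℕ) (hθ : (θ : ℝ) ≥ (2 * η ^ 2 / ε) * Real.log (1 / (δ * ε)))
    (X : Fin θ → Ω → ℝ)
    (hind : iIndepFun X μ)
    (hbound : ∀ i, ∀ᵐ ω ∂μ, X i ω ∈ Set.Icc (0 : ℝ) 1)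
    (φ : ℝ) (hφ : ε ≤ φ)
    (hmean : ∀ i, ∫ ω, X i ω ∂μ = φ) :
    μ {ω | φ - (1 / (θ : ℝ)) * ∑ i, X i ω ≥ φ / η} ≤ ENNReal.ofReal (δ * ε) := by
  have hη0 : 0 < η := one_pos.trans hη
  have hφ0 : 0 < φ := hε0.trans_le hφ
  have hδε : 0 < δ * ε := mul_pos hδ0 hε0
  have hlog : 0 < Real.log (1 / (δ * ε)) :=
    Real.log_pos (one_lt_one_div hδε (mul_lt_one_of_nonneg_of_lt_one_left hδ0.le hδ1 hε1.le))
  have hθ0 : (0 : ℝ) < θ := lt_of_lt_of_le (by positivity) hθ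
  have hX : ∀ i, AEMeasurable (X i) μ := fun i ↦ by
    refine (Integrable.of_integral_ne_zero ?_).aemeasurable
    rw [hmean i]
    exact hφ0.ne'
  have htail := measureReal_sum_le_one_sub_mul_le hX hind hbound hmean (inv_nonneg.2 hη0.le)
  rw [Fintype.card_fin] at htail
  have hset : {ω | φ - (1 / (θ : ℝ)) * ∑ i, X i ω ≥ φ / η} =
      {ω | ∑ i, X i ω ≤ (1 - η⁻¹) * (θ * φ)} := by
    ext ω
    rw [Set.mem_ofPred_eq, Set.mem_ofPred_eq, ge_iff_le, le_sub_comm, one_div,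
      inv_mul_le_iff₀ hθ0]
    ring_nf
  rw [hset, ← ofReal_measureReal]
  refine ENNReal.ofReal_le_ofReal (htail.trans ?_)
  rw [← Real.le_log_iff_exp_le hδε, neg_le, ← Real.log_inv, ← one_div]
  calc Real.log (1 / (δ * ε))
      = (2 * η ^ 2 / ε) * Real.log (1 / (δ * ε)) * ε * η⁻¹ ^ 2 / 2 := by field_simp
    _ ≤ θ * φ * η⁻¹ ^ 2 / 2 := by gcongr
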